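/- arXiv:hep-th/9509094 — 2 statements merged into one kernel-verified Lean document; each statement's English description precedes it below -/
import Mathlib

section
/- Let δq(t,q₀,…,q_{2k−1}) be a smooth ℝⁿ-valued function and G_L(t,q₀,…,q_{2k−1}) a smooth real function such that ⟨[L],δq⟩ + D_t G_L = 0 holds identically as functions of (t,q₀,…,q_{2k}). Then at every point the partial gradient of G_L with respect to q_{2k−1} satisfies ∂G_L/∂q_{2k−1} = (−1)^{k+1} W(q₀,…,q_k) δq; in particular, for every γ ∈ ℝⁿ with W(q₀,…,q_k)γ = 0 one has ⟨∂G_L/∂q_{2k−1}, γ⟩ = 0, i.e. the conserved quantity G_L of a Noether transformation is projectable along every kernel direction of the Hessian W (forward part of the paper's Theorem 1). -/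
open scoped BigOperators

noncomputable section

/-- `Vec n` is `ℝⁿ`. -/
abbrev Vec (n : ℕ) := Fin n → ℝ

/-- `Jet n m` packages the variables `q₀, …, q_m`, each a vector of `ℝⁿ`. -/
abbrev Jet (n m : ℕ) := Fin (m+1) → Vec n

/-- The standard inner product on `ℝⁿ`. -/
def dot {n : ℕ} (u v : Vec n) : ℝ := ∑ a, u a * v a

/-- Forget the top variable `q_{m+1}`. -/
def res {n m : ℕ} (q : Jet n (m+1)) : Jet n m := fun i => q i.castSucc

/-- The shift `(shft q) i = q (i+1)`. -/
def shft {n m : ℕ} (q : Jet n (m+1)) : Jet n m := fun i => q i.succ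

/-- Restriction of a jet to a lower-order jet. -/
def trunc {n m m' : ℕ} (h : m' ≤ m) (q : Jet n m) : Jet n m' :=
  fun i => q (Fin.castLE (Nat.succ_le_succ h) i)

/-- The partial gradient of `f` in the slot `q_i`, identified with a vector of `ℝⁿ`
via the standard inner product (i.e. the vector representing the partial
differential `∂f/∂q_i`). -/
def gradSlot {n m : ℕ} (f : Jet n m → ℝ) (q : Jet n m) (i : Fin (m+1)) : Vec n :=
  fun a => fderiv ℝ f q (Pi.single i (Pi.single a 1))

/-- The formal total time derivative of a time-independent function
`f(q₀,…,q_m)`: `D_t f = Σ_i (∂f/∂q_i)·q_{i+1}`, a function of `(q₀,…,q_{m+1})`. -/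
def Dt0 {n m : ℕ} {F : Type*} [NormedAddCommGroup F] [NormedSpace ℝ F]
    (f : Jet n m → F) (q : Jet n (m+1)) : F :=
  fderiv ℝ f (res q) (shft q)

/-- Iterated formal total time derivative (time-independent functions). -/
def DtIter0 {n m : ℕ} {F : Type*} [NormedAddCommGroup F] [NormedSpace ℝ F] :
    (r : ℕ) → (Jet n m → F) → (Jet n (m + r) → F)
  | 0, f => f
  | r+1, f => Dt0 (DtIter0 r f)

/-- The formal total time derivative of a time-dependent function
`f(t,q₀,…,q_m)`: `D_t f = ∂f/∂t + Σ_i (∂f/∂q_i)·q_{i+1}`. -/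
def Dt {n m : ℕ} {F : Type*} [NormedAddCommGroup F] [NormedSpace ℝ F]
    (f : ℝ × Jet n m → F) (x : ℝ × Jet n (m+1)) : F :=
  fderiv ℝ f (x.1, res x.2) (1, shft x.2)

/-- Iterated formal total time derivative (time-dependent functions). -/
def DtIter {n m : ℕ} {F : Type*} [NormedAddCommGroup F] [NormedSpace ℝ F] :
    (r : ℕ) → (ℝ × Jet n m → F) → (ℝ × Jet n (m + r) → F)
  | 0, f => f
  | r+1, f => Dt (DtIter r f)

/-- The partial gradient in the slot `q_i` of a time-dependent function. -/
def gradSlotT {n m : ℕ} (f : ℝ × Jet n m → ℝ) (x : ℝ × Jet n m) (i : Fin (m+1)) : Vec n :=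
  fun a => fderiv ℝ f x (0, Pi.single i (Pi.single a 1))

/-- The Ostrogradskii momenta of a Lagrangian `L(q₀,…,q_{k+1})` of order `k+1`:
`mom L j` is the momentum `p̂^{k-j}`, a function of `(q₀,…,q_{k+j+1})`.
It is defined by the downward recursion `p̂^{k} = ∂L/∂q_{k+1}` and
`p̂^{i-1} = ∂L/∂q_i − D_t p̂^i`. -/
def mom {n k : ℕ} (L : Jet n (k+1) → ℝ) : (j : ℕ) → (Jet n (k + j + 1) → Vec n)
  | 0 => fun q => gradSlot L q (Fin.last (k+1))
  | j+1 => fun q =>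
      gradSlot L (trunc (by omega) q) ⟨k - j, by omega⟩ - Dt0 (mom L j) q

/-- The Euler–Lagrange expression `[L] = Σ_{r=0}^{k+1} (−1)^r D_t^r (∂L/∂q_r)`
of a Lagrangian of order `k+1`, a function of `(q₀,…,q_{2(k+1)})`. -/
def EL {n k : ℕ} (L : Jet n (k+1) → ℝ) (q : Jet n (k+k+2)) : Vec n :=
  ∑ r : Fin (k+2),
    ((-1 : ℝ)) ^ (r : ℕ) •
      DtIter0 (r : ℕ) (fun q' => gradSlot L q' r)
        (trunc (by have := r.isLt; omega) q)

/-- The Hessian `W = ∂²L/∂q_{k+1}∂q_{k+1}` of a Lagrangian of order `k+1`,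
as an operator `ℝⁿ → ℝⁿ` (a function of `(q₀,…,q_{k+1})`). -/
def hessOp {n k : ℕ} (L : Jet n (k+1) → ℝ) (q : Jet n (k+1)) (v : Vec n) : Vec n :=
  fun a => fderiv ℝ (fun q' => gradSlot L q' (Fin.last (k+1)) a) q
    (Pi.single (Fin.last (k+1)) v)

/-- The first partial Legendre–Ostrogradskii transformation
`F₀ : (q₀,…,q_{2k+1}) ↦ (q₀,…,q_{2k}; p̂⁰)`. -/
def F0 {n k : ℕ} (L : Jet n (k+1) → ℝ) (q : Jet n (k+k+1)) : Jet n (k+k) × Vec n :=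
  (res q, mom L k q)

/-- Pull-back through `F₀` of a (time-dependent) function on the intermediate
space `P₁`. -/
def pullF0 {n k : ℕ} {F : Type*} (L : Jet n (k+1) → ℝ)
    (g : ℝ × (Jet n (k+k) × Vec n) → F) (x : ℝ × Jet n (k+k+1)) : F :=
  g (x.1, F0 L x.2)

/-- The intermediate evolution operator `K₀`:
`K₀·g = (∂g/∂t)∘F₀ + Σ_{i=0}^{2k} ((∂g/∂q_i)∘F₀)·q_{i+1} + ((∂g/∂p⁰)∘F₀)·(∂L/∂q₀)`. -/
def K0 {n k : ℕ} {F : Type*} [NormedAddCommGroup F] [NormedSpace ℝ F]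
    (L : Jet n (k+1) → ℝ)
    (g : ℝ × (Jet n (k+k) × Vec n) → F) (x : ℝ × Jet n (k+k+1)) : F :=
  fderiv ℝ g (x.1, F0 L x.2)
    (1, shft x.2, gradSlot L (trunc (by omega) x.2) 0)

/-- The partial gradient `∂g/∂p⁰` of a function on `P₁`, as a vector of `ℝⁿ`. -/
def gradMom {n k : ℕ} (g : ℝ × (Jet n (k+k) × Vec n) → ℝ)
    (x : ℝ × (Jet n (k+k) × Vec n)) : Vec n :=
  fun a => fderiv ℝ g x (0, 0, Pi.single a 1)

theorem res_add_single_last {n m : ℕ} (q : Jet n (m+1)) (v : Vec n) :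
    res (q + Pi.single (Fin.last (m+1)) v) = res q := by
  funext i
  simp [res]

theorem shft_add_single_last {n m : ℕ} (q : Jet n (m+1)) (v : Vec n) :
    shft (q + Pi.single (Fin.last (m+1)) v) = shft q + Pi.single (Fin.last m) v := by
  funext i
  simp only [shft, Pi.add_apply, Pi.single_apply, ← Fin.succ_last, Fin.succ_inj]

theorem trunc_add_single_last_of_lt {n m m' : ℕ} (h : m' < m) (q : Jet n m) (v : Vec n) :
    trunc h.le (q + Pi.single (Fin.last m) v) = trunc h.le q := by
  funext i
  have hi : Fin.castLE (Nat.succ_le_succ h.le) i ≠ Fin.last m := by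
    simp only [ne_eq, Fin.ext_iff, Fin.val_castLE, Fin.val_last]
    omega
  simp [trunc, Pi.single_eq_of_ne hi]

theorem trunc_add_single_last_of_eq {n m m' : ℕ} (h : m' = m) (q : Jet n m) (v : Vec n) :
    trunc h.le (q + Pi.single (Fin.last m) v) = trunc h.le q + Pi.single (Fin.last m') v := by
  subst h
  rfl

section TotalDerivative

variable {F : Type*} [NormedAddCommGroup F] [NormedSpace ℝ F]

theorem contDiff_Dt0 {n m : ℕ} {f : Jet n m → F} (hf : ContDiff ℝ (⊤ : ℕ∞) f) :
    ContDiff ℝ (⊤ : ℕ∞) (Dt0 f) := by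
  have hres : ContDiff ℝ (⊤ : ℕ∞) (res : Jet n (m+1) → Jet n m) := by
    unfold res; fun_prop
  have hshft : ContDiff ℝ (⊤ : ℕ∞) (shft : Jet n (m+1) → Jet n m) := by
    unfold shft; fun_prop
  exact ((hf.fderiv_right (m := (⊤ : ℕ∞)) le_rfl).comp hres).clm_apply hshft

theorem contDiff_DtIter0 {n m : ℕ} {f : Jet n m → F} (hf : ContDiff ℝ (⊤ : ℕ∞) f) (r : ℕ) :
    ContDiff ℝ (⊤ : ℕ∞) (DtIter0 r f) := by
  induction r with
  | zero => exact hf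
  | succ r ih => exact contDiff_Dt0 ih

theorem Dt0_add_single_last {n m : ℕ} (f : Jet n m → F) (q : Jet n (m+1)) (v : Vec n) :
    Dt0 f (q + Pi.single (Fin.last (m+1)) v) =
      Dt0 f q + fderiv ℝ f (res q) (Pi.single (Fin.last m) v) := by
  simp only [Dt0, res_add_single_last, shft_add_single_last, map_add]

theorem Dt_add_single_last {n m : ℕ} (f : ℝ × Jet n m → F) (t : ℝ) (q : Jet n (m+1))
    (v : Vec n) :
    Dt f (t, q + Pi.single (Fin.last (m+1)) v) =
      Dt f (t, q) + fderiv ℝ f (t, res q) (0, Pi.single (Fin.last m) v) := by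
  simp only [Dt, res_add_single_last, shft_add_single_last, ← map_add, Prod.mk_add_mk, add_zero]

theorem fderiv_Dt0_single_last {n m : ℕ} {f : Jet n m → F} (hf : ContDiff ℝ (⊤ : ℕ∞) f)
    (q : Jet n (m+1)) (v : Vec n) :
    fderiv ℝ (Dt0 f) q (Pi.single (Fin.last (m+1)) v) =
      fderiv ℝ f (res q) (Pi.single (Fin.last m) v) := by
  have hd : DifferentiableAt ℝ (Dt0 f) q := (contDiff_Dt0 hf).differentiable (by simp) q
  rw [← hd.lineDeriv_eq_fderiv, lineDeriv]
  have hline : (fun s : ℝ => Dt0 f (q + s • (Pi.single (Fin.last (m+1)) v : Jet n (m+1)))) = fun s =>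
      Dt0 f q + s • fderiv ℝ f (res q) (Pi.single (Fin.last m) v) := by
    funext s
    rw [← Pi.single_smul, Dt0_add_single_last, Pi.single_smul, map_smul]
  rw [hline]
  simpa using (((hasDerivAt_id (0 : ℝ)).smul_const
    (fderiv ℝ f (res q) (Pi.single (Fin.last m) v))).const_add (Dt0 f q)).deriv

theorem fderiv_DtIter0_single_last {n m : ℕ} {f : Jet n m → F} (hf : ContDiff ℝ (⊤ : ℕ∞) f)
    (r : ℕ) (q : Jet n (m+r)) (v : Vec n) :
    fderiv ℝ (DtIter0 r f) q (Pi.single (Fin.last (m+r)) v) =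
      fderiv ℝ f (trunc (Nat.le_add_right m r) q) (Pi.single (Fin.last m) v) := by
  induction r with
  | zero => rfl
  | succ r ih => exact (fderiv_Dt0_single_last (contDiff_DtIter0 hf r) q v).trans (ih (res q))

theorem DtIter0_succ_add_single_last {n m : ℕ} {f : Jet n m → F}
    (hf : ContDiff ℝ (⊤ : ℕ∞) f) (r : ℕ) (q : Jet n (m+(r+1))) (v : Vec n) :
    DtIter0 (r+1) f (q + Pi.single (Fin.last (m+(r+1))) v) =
      DtIter0 (r+1) f q +
        fderiv ℝ f (trunc (Nat.le_add_right m (r+1)) q) (Pi.single (Fin.last m) v) :=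
  (Dt0_add_single_last (DtIter0 r f) q v).trans
    (congrArg (DtIter0 (r+1) f q + ·) (fderiv_DtIter0_single_last hf r (res q) v))

end TotalDerivative

theorem contDiff_gradSlot {n m : ℕ} {L : Jet n m → ℝ} (hL : ContDiff ℝ (⊤ : ℕ∞) L)
    (i : Fin (m+1)) : ContDiff ℝ (⊤ : ℕ∞) (fun q => gradSlot L q i) :=
  contDiff_pi.2 fun _ => (hL.fderiv_right (m := (⊤ : ℕ∞)) le_rfl).clm_apply contDiff_const

theorem fderiv_gradSlot_last {n k : ℕ} {L : Jet n (k+1) → ℝ} (hL : ContDiff ℝ (⊤ : ℕ∞) L)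
    (q : Jet n (k+1)) (v : Vec n) :
    fderiv ℝ (fun q' => gradSlot L q' (Fin.last (k+1))) q (Pi.single (Fin.last (k+1)) v) =
      hessOp L q v := by
  funext a
  have hd := (contDiff_gradSlot hL (Fin.last (k+1))).differentiable (by simp) q
  rw [hessOp, fderiv_apply hd]
  rfl

theorem EL_add_single_last {n k : ℕ} {L : Jet n (k+1) → ℝ} (hL : ContDiff ℝ (⊤ : ℕ∞) L)
    (q : Jet n (k+k+2)) (v : Vec n) :
    EL L (q + Pi.single (Fin.last (k+k+2)) v) =
      EL L q + ((-1 : ℝ)) ^ (k+1) • hessOp L (trunc (by omega) q) v := by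
  rw [EL, EL, Fin.sum_univ_castSucc (n := k+1), Fin.sum_univ_castSucc (n := k+1)]
  refine Eq.trans ?_ (add_assoc _ _ _).symm
  congr 1
  · refine Finset.sum_congr rfl fun r _ => ?_
    have hr : k + 1 + (r.castSucc : ℕ) < k + k + 2 := by
      have := r.isLt
      simp only [Fin.val_castSucc]
      omega
    rw [trunc_add_single_last_of_lt hr]
  · refine Eq.trans (congrArg _ ?_) (smul_add ((-1 : ℝ) ^ (k+1)) _ _)
    have hk : k + 1 + (k + 1) = k + k + 2 := by omega
    change DtIter0 (k+1) _ (trunc hk.le _) = DtIter0 (k+1) _ (trunc hk.le _) + _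
    rw [trunc_add_single_last_of_eq hk,
      DtIter0_succ_add_single_last (contDiff_gradSlot hL (Fin.last (k+1))),
      fderiv_gradSlot_last hL]
    rfl

theorem dot_hessOp {n k : ℕ} {L : Jet n (k+1) → ℝ} (hL : ContDiff ℝ (⊤ : ℕ∞) L)
    (q : Jet n (k+1)) (u v : Vec n) :
    dot (hessOp L q u) v =
      fderiv ℝ (fderiv ℝ L) q (Pi.single (Fin.last (k+1)) u)
        (Pi.single (Fin.last (k+1)) v) := by
  have hd : DifferentiableAt ℝ (fderiv ℝ L) q :=
    (hL.fderiv_right (m := (⊤ : ℕ∞)) le_rfl).differentiable (by simp) q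
  have hv : (Pi.single (Fin.last (k+1)) v : Jet n (k+1)) =
      ∑ a, v a • Pi.single (Fin.last (k+1)) (Pi.single a (1 : ℝ)) := by
    conv_lhs => rw [pi_eq_sum_univ' v]
    simp only [← Pi.single_smul]
    exact map_sum (LinearMap.single ℝ (fun _ : Fin (k+1+1) => Vec n) (Fin.last (k+1))) _ _
  rw [hv, map_sum, dot]
  refine Finset.sum_congr rfl fun a _ => ?_
  simp only [hessOp, gradSlot, map_smul, smul_eq_mul, mul_comm (v a)]
  rw [fderiv_clm_apply hd (differentiableAt_const _)]
  simp

theorem dot_hessOp_comm {n k : ℕ} {L : Jet n (k+1) → ℝ} (hL : ContDiff ℝ (⊤ : ℕ∞) L)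
    (q : Jet n (k+1)) (u v : Vec n) :
    dot (hessOp L q u) v = dot (hessOp L q v) u := by
  rw [dot_hessOp hL, dot_hessOp hL]
  exact (hL.contDiffAt.isSymmSndFDerivAt
    (by simpa using WithTop.coe_le_coe.2 (le_top : (2 : ℕ∞) ≤ ⊤))).eq _ _

theorem dot_add_left {n : ℕ} (u v w : Vec n) : dot (u + v) w = dot u w + dot v w := by
  simp [dot, add_mul, Finset.sum_add_distrib]

theorem dot_smul_left {n : ℕ} (c : ℝ) (u v : Vec n) : dot (c • u) v = c * dot u v := by
  simp [dot, Finset.mul_sum, mul_assoc]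

theorem dot_single_one {n : ℕ} (u : Vec n) (a : Fin n) : dot u (Pi.single a 1) = u a := by
  simp [dot, Pi.single_apply]

theorem exists_res_eq {n m : ℕ} (q : Jet n m) : ∃ Q : Jet n (m+1), res Q = q :=
  ⟨Fin.snoc (α := fun _ => Vec n) q 0,
    funext fun i => Fin.snoc_castSucc (α := fun _ => Vec n) 0 q i⟩

/-- forward part of Theorem 1.
If `δq(t,q₀,…,q_{2k+1})` is a Noether transformation of the Lagrangian `L` of
order `k+1` with conserved quantity `G_L`, i.e. `⟨[L],δq⟩ + D_t G_L = 0`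
identically, then at every point `∂G_L/∂q_{2k+1} = (−1)^{(k+1)+1} W δq`; in
particular `⟨∂G_L/∂q_{2k+1}, γ⟩ = 0` for every `γ` in the kernel of the
Hessian `W`, i.e. `G_L` is projectable along every kernel direction of `W`. -/
theorem noether_conserved_quantity_projectable
    (n k : ℕ) (hn : 1 ≤ n)
    (L : Jet n (k+1) → ℝ) (hL : ContDiff ℝ (⊤ : ℕ∞) L)
    (δq : ℝ × Jet n (k+k+1) → Vec n) (hδq : ContDiff ℝ (⊤ : ℕ∞) δq)
    (Glag : ℝ × Jet n (k+k+1) → ℝ) (hGL : ContDiff ℝ (⊤ : ℕ∞) Glag)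
    (hNoether : ∀ (t : ℝ) (q : Jet n (k+k+2)),
      dot (EL L q) (δq (t, res q)) + Dt Glag (t, q) = 0) :
    ∀ (t : ℝ) (q : Jet n (k+k+1)),
      gradSlotT Glag (t, q) (Fin.last (k+k+1)) =
        ((-1 : ℝ)) ^ ((k+1)+1) • hessOp L (trunc (by omega) q) (δq (t, q)) ∧
      ∀ γ : Vec n, hessOp L (trunc (by omega) q) γ = 0 →
        dot (gradSlotT Glag (t, q) (Fin.last (k+k+1))) γ = 0 := by
  intro t q
  have hgrad : gradSlotT Glag (t, q) (Fin.last (k+k+1)) =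
      ((-1 : ℝ)) ^ ((k+1)+1) • hessOp L (trunc (by omega) q) (δq (t, q)) := by
    obtain ⟨Q, rfl⟩ := exists_res_eq q
    funext a
    have hQ := hNoether t Q
    have hQa := hNoether t (Q + Pi.single (Fin.last (k+k+2)) (Pi.single a 1))
    rw [EL_add_single_last hL, res_add_single_last, Dt_add_single_last, dot_add_left,
      dot_smul_left, dot_hessOp_comm hL, dot_single_one] at hQa
    change fderiv ℝ Glag (t, res Q) (0, Pi.single (Fin.last (k+k+1)) (Pi.single a 1)) =
      (-1 : ℝ) ^ ((k+1)+1) * hessOp L (trunc (by omega) Q) (δq (t, res Q)) a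
    rw [pow_succ]
    linarith
  refine ⟨hgrad, fun γ hγ => ?_⟩
  rw [hgrad, dot_smul_left, dot_hessOp_comm hL, hγ]
  simp [dot]

end
end

section
/- For the curvature Lagrangian L(x₀,x₁,x₂) = α√δ₂/δ₁, at every point with δ₁ > 0 and δ₂ > 0 the partial differential of L with respect to x₁ is the covector v ↦ −(α/√δ₂)[(D_tδ₁/(2δ₁)) B(ξ₂,v) + (δ₂/δ₁²) B(ξ₁,v)] (where D_tδ₁ = 2(x₁ x₂)), and consequently the Ostrogradskii momentum p̂⁰, a function of (x₀,x₁,x₂,x₃), equals −(α/√δ₂) ξ₃. -/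
open scoped BigOperators Matrix

noncomputable section

/-- `V d` is `ℝ^d`. -/
abbrev V (d : ℕ) := Fin d → ℝ

variable {d : ℕ}

/-- The bilinear form determined by the symmetric matrix `B`:
`(u v) = B(u,v) = uᵀ B v`. -/
def bf (B : Matrix (Fin d) (Fin d) ℝ) (u v : V d) : ℝ := u ⬝ᵥ B *ᵥ v

/-- The Gram determinant of a family of vectors with respect to `B`. -/
def gram (B : Matrix (Fin d) (Fin d) ℝ) {m : ℕ} (x : Fin m → V d) : ℝ :=
  (Matrix.of fun i j => bf B (x i) (x j)).det

/-- `δ₁ = (x₁ x₁)` as a `1×1` Gram determinant. -/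
def d1 (B : Matrix (Fin d) (Fin d) ℝ) (x1 : V d) : ℝ := gram B ![x1]

/-- `δ₂`, the Gram determinant of `x₁, x₂`. -/
def d2 (B : Matrix (Fin d) (Fin d) ℝ) (x1 x2 : V d) : ℝ := gram B ![x1, x2]

/-- `δ₃`, the Gram determinant of `x₁, x₂, x₃`. -/
def d3 (B : Matrix (Fin d) (Fin d) ℝ) (x1 x2 x3 : V d) : ℝ := gram B ![x1, x2, x3]

/-- The orthogonalized vector `ξ₂ = x₂ − ((x₂ ξ₁)/(ξ₁ ξ₁)) ξ₁` (with `ξ₁ = x₁`). -/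
def xi2 (B : Matrix (Fin d) (Fin d) ℝ) (x1 x2 : V d) : V d :=
  x2 - (bf B x2 x1 / bf B x1 x1) • x1

/-- The orthogonalized vector
`ξ₃ = x₃ − ((x₃ ξ₂)/(ξ₂ ξ₂)) ξ₂ − ((x₃ ξ₁)/(ξ₁ ξ₁)) ξ₁`. -/
def xi3 (B : Matrix (Fin d) (Fin d) ℝ) (x1 x2 x3 : V d) : V d :=
  x3 - (bf B x3 (xi2 B x1 x2) / bf B (xi2 B x1 x2) (xi2 B x1 x2)) • xi2 B x1 x2
     - (bf B x3 x1 / bf B x1 x1) • x1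

/-- The curvature Lagrangian `L(x₀,x₁,x₂) = α √δ₂ / δ₁` of the relativistic
particle (independent of `x₀`). -/
def Lc (B : Matrix (Fin d) (Fin d) ℝ) (α : ℝ) (x : V d × V d × V d) : ℝ :=
  α * Real.sqrt (d2 B x.2.1 x.2.2) / d1 B x.2.1

/-- The Ostrogradskii momentum `p̂¹`, identified with a vector via `B`:
the (for nondegenerate symmetric `B`, unique) vector with
`B(p̂¹,v) = (∂L/∂x₂)[v]` for all `v`. -/
def p1h (B : Matrix (Fin d) (Fin d) ℝ) (α : ℝ) (x0 x1 x2 : V d) : V d :=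
  B⁻¹ *ᵥ fun a => fderiv ℝ (Lc B α) (x0, x1, x2) (0, 0, Pi.single a 1)

/-- The Ostrogradskii momentum `p̂⁰`, identified with a vector via `B`:
the vector with `B(p̂⁰,v) = (∂L/∂x₁)[v] − (D_t B(p̂¹,·))[v]` for all `v`. -/
def p0h (B : Matrix (Fin d) (Fin d) ℝ) (α : ℝ) (x0 x1 x2 x3 : V d) : V d :=
  B⁻¹ *ᵥ fun a =>
    fderiv ℝ (Lc B α) (x0, x1, x2) (0, Pi.single a 1, 0) -
      fderiv ℝ (fun y : V d × V d × V d =>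
          bf B (p1h B α y.1 y.2.1 y.2.2) (Pi.single a 1))
        (x0, x1, x2) (x1, x2, x3)

/-- The Euler–Lagrange expression `[L] = ∂L/∂x₀ − D_t(B(p̂⁰,·))` as a covector,
evaluated on the vector `v`. -/
def ELc (B : Matrix (Fin d) (Fin d) ℝ) (α : ℝ) (x0 x1 x2 x3 x4 : V d) (v : V d) : ℝ :=
  fderiv ℝ (Lc B α) (x0, x1, x2) (v, 0, 0) -
    fderiv ℝ (fun y : V d × V d × V d × V d =>
        bf B (p0h B α y.1 y.2.1 y.2.2.1 y.2.2.2) v)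
      (x0, x1, x2, x3) (x1, x2, x3, x4)

/-- The formal total time derivative of a time-dependent function
`f(t,x₀,x₁,x₂,x₃)`, a function of `(t,x₀,…,x₄)`. -/
def DtT (f : ℝ × (V d × V d × V d × V d) → ℝ)
    (t : ℝ) (x0 x1 x2 x3 x4 : V d) : ℝ :=
  fderiv ℝ f (t, (x0, x1, x2, x3)) (1, (x1, x2, x3, x4))

lemma bf_comm {B : Matrix (Fin d) (Fin d) ℝ} (hB : B.IsSymm) (u v : V d) :
    bf B u v = bf B v u := by
  unfold bf
  rw [Matrix.dotProduct_mulVec, ← Matrix.mulVec_transpose, hB.eq, dotProduct_comm]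

lemma bf_sub_left (B : Matrix (Fin d) (Fin d) ℝ) (u v w : V d) :
    bf B (u - v) w = bf B u w - bf B v w := by
  simp [bf, sub_dotProduct]

lemma bf_smul_left (B : Matrix (Fin d) (Fin d) ℝ) (r : ℝ) (u w : V d) :
    bf B (r • u) w = r * bf B u w := by
  simp [bf, smul_dotProduct]

lemma bf_zero_left (B : Matrix (Fin d) (Fin d) ℝ) (w : V d) : bf B 0 w = 0 := by
  simp [bf]

lemma d1_eq (B : Matrix (Fin d) (Fin d) ℝ) (x : V d) : d1 B x = bf B x x := by
  simp [d1, gram]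

lemma d2_eq {B : Matrix (Fin d) (Fin d) ℝ} (hB : B.IsSymm) (x y : V d) :
    d2 B x y = bf B x x * bf B y y - bf B x y ^ 2 := by
  simp [d2, gram, Matrix.det_fin_two, bf_comm hB y x, sq]

/-- The vector representing the functional `bf B y` on the standard basis is `y` itself. -/
lemma inv_mulVec_bf_single {B : Matrix (Fin d) (Fin d) ℝ} (hB : B.IsSymm)
    (hdet : IsUnit B.det) (y : V d) :
    (B⁻¹ *ᵥ fun a => bf B y (Pi.single a 1)) = y := by
  have h : (fun a => bf B y (Pi.single a 1)) = B *ᵥ y := by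
    funext a
    rw [bf_comm hB, bf, single_one_dotProduct]
  rw [h, Matrix.mulVec_mulVec, Matrix.nonsing_inv_mul B hdet, Matrix.one_mulVec]

lemma differentiable_bf {E : Type*} [NormedAddCommGroup E] [NormedSpace ℝ E]
    (B : Matrix (Fin d) (Fin d) ℝ) {f g : E → V d}
    (hf : Differentiable ℝ f) (hg : Differentiable ℝ g) :
    Differentiable ℝ fun z => bf B (f z) (g z) := by
  unfold bf Matrix.mulVec dotProduct
  fun_prop

lemma hasDerivAt_bf (B : Matrix (Fin d) (Fin d) ℝ) {f g : ℝ → V d} {f' g' : V d} {t : ℝ}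
    (hf : HasDerivAt f f' t) (hg : HasDerivAt g g' t) :
    HasDerivAt (fun s => bf B (f s) (g s)) (bf B f' (g t) + bf B (f t) g') t := by
  have hmul : HasDerivAt (fun s => B *ᵥ g s) (B *ᵥ g') t :=
    (LinearMap.toContinuousLinearMap (Matrix.mulVecLin B)).hasFDerivAt.comp_hasDerivAt t hg
  have hsum := HasDerivAt.fun_sum (u := Finset.univ) fun i _ =>
    (hasDerivAt_pi.1 hf i).mul (hasDerivAt_pi.1 hmul i)
  simpa [bf, dotProduct, Finset.sum_add_distrib] using hsum

lemma hasDerivAt_line {E : Type*} [NormedAddCommGroup E] [NormedSpace ℝ E] (x v : E) :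
    HasDerivAt (fun t : ℝ => x + t • v) v 0 := by
  simpa using ((hasDerivAt_id (0 : ℝ)).smul_const v).const_add x

/-- The derivative of a differentiable function in a direction is read off on a line. -/
lemma fderiv_apply_eq_of_hasDerivAt {E : Type*} [NormedAddCommGroup E] [NormedSpace ℝ E]
    {f : E → ℝ} {x v : E} {r : ℝ} (hf : DifferentiableAt ℝ f x)
    (h : HasDerivAt (fun t : ℝ => f (x + t • v)) r 0) : fderiv ℝ f x v = r :=
  hf.lineDeriv_eq_fderiv.symm.trans h.deriv

lemma differentiableAt_div {E : Type*} [NormedAddCommGroup E] [NormedSpace ℝ E]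
    {f g : E → ℝ} {x : E} (hf : DifferentiableAt ℝ f x) (hg : DifferentiableAt ℝ g x)
    (hx : g x ≠ 0) : DifferentiableAt ℝ (fun y => f y / g y) x := by
  simp only [div_eq_mul_inv]
  exact hf.fun_mul (hg.fun_inv hx)

lemma differentiable_d1 (B : Matrix (Fin d) (Fin d) ℝ) :
    Differentiable ℝ fun y : V d × V d × V d => d1 B y.2.1 := by
  simp only [d1_eq]
  exact differentiable_bf B (by fun_prop) (by fun_prop)

lemma differentiable_d2 {B : Matrix (Fin d) (Fin d) ℝ} (hB : B.IsSymm) :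
    Differentiable ℝ fun y : V d × V d × V d => d2 B y.2.1 y.2.2 := by
  simp only [d2_eq hB]
  exact ((differentiable_bf B (by fun_prop) (by fun_prop)).mul
    (differentiable_bf B (by fun_prop) (by fun_prop))).sub
    ((differentiable_bf B (by fun_prop) (by fun_prop)).pow 2)

lemma hasDerivAt_d1_line {B : Matrix (Fin d) (Fin d) ℝ} (hB : B.IsSymm) (x v : V d) :
    HasDerivAt (fun t : ℝ => d1 B (x + t • v)) (2 * bf B x v) 0 := by
  simp only [d1_eq]
  convert hasDerivAt_bf B (hasDerivAt_line x v) (hasDerivAt_line x v) using 1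
  simp [bf_comm hB v x, two_mul]

lemma hasDerivAt_d2_line {B : Matrix (Fin d) (Fin d) ℝ} (hB : B.IsSymm) (x y v w : V d) :
    HasDerivAt (fun t : ℝ => d2 B (x + t • v) (y + t • w))
      (2 * bf B x v * bf B y y + bf B x x * (2 * bf B y w)
        - 2 * bf B x y * (bf B y v + bf B x w)) 0 := by
  simp only [d2_eq hB]
  have hx := hasDerivAt_line x v
  have hy := hasDerivAt_line y w
  refine (((hasDerivAt_bf B hx hx).fun_mul (hasDerivAt_bf B hy hy)).fun_sub
    ((hasDerivAt_bf B hx hy).fun_pow 2)).congr_deriv ?_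
  simp [bf_comm hB v x, bf_comm hB w y, bf_comm hB v y]
  ring

lemma differentiableAt_Lc {B : Matrix (Fin d) (Fin d) ℝ} (hB : B.IsSymm) (α : ℝ)
    {x0 x1 x2 : V d} (h1 : 0 < d1 B x1) (h2 : 0 < d2 B x1 x2) :
    DifferentiableAt ℝ (Lc B α) (x0, x1, x2) := by
  have e1 : DifferentiableAt ℝ (fun y : V d × V d × V d => d1 B y.2.1) (x0, x1, x2) :=
    (differentiable_d1 B).differentiableAt
  have e2 : DifferentiableAt ℝ (fun y : V d × V d × V d => d2 B y.2.1 y.2.2) (x0, x1, x2) :=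
    (differentiable_d2 hB).differentiableAt
  exact differentiableAt_div ((e2.sqrt h2.ne').const_mul α) e1 h1.ne'

lemma fderiv_Lc_apply {B : Matrix (Fin d) (Fin d) ℝ} (hB : B.IsSymm) (α : ℝ)
    {x0 x1 x2 : V d} (h1 : 0 < d1 B x1) (h2 : 0 < d2 B x1 x2) (u v w : V d) :
    fderiv ℝ (Lc B α) (x0, x1, x2) (u, v, w) =
      (α * ((2 * bf B x1 v * bf B x2 x2 + bf B x1 x1 * (2 * bf B x2 w)
        - 2 * bf B x1 x2 * (bf B x2 v + bf B x1 w)) / (2 * √(d2 B x1 x2))) * d1 B x1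
        - α * √(d2 B x1 x2) * (2 * bf B x1 v)) / d1 B x1 ^ 2 := by
  apply fderiv_apply_eq_of_hasDerivAt (differentiableAt_Lc hB α h1 h2)
  have h := (((hasDerivAt_d2_line hB x1 x2 v w).sqrt (by simpa using h2.ne')).const_mul α).fun_div
    (hasDerivAt_d1_line hB x1 v) (by simpa using h1.ne')
  simpa [Lc] using h

lemma bf_xi2_left {B : Matrix (Fin d) (Fin d) ℝ} (hB : B.IsSymm) (x1 x2 v : V d) :
    bf B (xi2 B x1 x2) v = bf B x2 v - bf B x1 x2 / d1 B x1 * bf B x1 v := by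
  rw [xi2, bf_sub_left, bf_smul_left, bf_comm hB x2 x1, d1_eq]

lemma bf_xi2_self {B : Matrix (Fin d) (Fin d) ℝ} (hB : B.IsSymm) {x1 : V d} (x2 : V d)
    (h1 : 0 < d1 B x1) :
    bf B (xi2 B x1 x2) (xi2 B x1 x2) = d2 B x1 x2 / d1 B x1 := by
  rw [bf_xi2_left hB, bf_comm hB x2, bf_comm hB x1 (xi2 B x1 x2), bf_xi2_left hB,
    bf_xi2_left hB, d2_eq hB, bf_comm hB x2 x1, ← d1_eq B x1]
  field_simp
  ring

lemma bf_xi3_left {B : Matrix (Fin d) (Fin d) ℝ} (hB : B.IsSymm) {x1 : V d} (x2 x3 v : V d)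
    (h1 : 0 < d1 B x1) :
    bf B (xi3 B x1 x2 x3) v = bf B x3 v
      - (bf B x2 x3 - bf B x1 x2 / d1 B x1 * bf B x1 x3) / (d2 B x1 x2 / d1 B x1)
        * (bf B x2 v - bf B x1 x2 / d1 B x1 * bf B x1 v)
      - bf B x1 x3 / d1 B x1 * bf B x1 v := by
  rw [xi3, bf_sub_left, bf_sub_left, bf_smul_left, bf_smul_left, bf_xi2_self hB x2 h1,
    bf_comm hB x3 (xi2 B x1 x2), bf_xi2_left hB, bf_xi2_left hB, bf_comm hB x3 x1, ← d1_eq]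

lemma p1h_eq {B : Matrix (Fin d) (Fin d) ℝ} (hB : B.IsSymm) (hdet : IsUnit B.det) (α : ℝ)
    {x0 x1 x2 : V d} (h1 : 0 < d1 B x1) (h2 : 0 < d2 B x1 x2) :
    p1h B α x0 x1 x2 = (α / √(d2 B x1 x2)) • xi2 B x1 x2 := by
  rw [p1h, ← inv_mulVec_bf_single hB hdet ((α / √(d2 B x1 x2)) • xi2 B x1 x2)]
  congr 1
  funext a
  have hs : 0 < √(d2 B x1 x2) := Real.sqrt_pos.2 h2
  rw [fderiv_Lc_apply hB α h1 h2, bf_smul_left, bf_xi2_left hB, bf_comm hB x1 0,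
    bf_comm hB x2 0, bf_zero_left, bf_zero_left, ← d1_eq B x1]
  field_simp
  ring

lemma fderiv_bf_p1h {B : Matrix (Fin d) (Fin d) ℝ} (hB : B.IsSymm) (hdet : IsUnit B.det)
    (α : ℝ) {x0 x1 x2 : V d} (x3 : V d) (h1 : 0 < d1 B x1) (h2 : 0 < d2 B x1 x2) (v : V d) :
    fderiv ℝ (fun y : V d × V d × V d => bf B (p1h B α y.1 y.2.1 y.2.2) v)
        (x0, x1, x2) (x1, x2, x3) =
      α / √(d2 B x1 x2) * (bf B x3 v
        - ((bf B x2 x2 + bf B x1 x3) * d1 B x1 - 2 * bf B x1 x2 ^ 2) / d1 B x1 ^ 2 * bf B x1 v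
        - bf B x1 x2 / d1 B x1 * bf B x2 v
        - (d1 B x1 * bf B x2 x3 - bf B x1 x2 * bf B x1 x3) / d2 B x1 x2
          * (bf B x2 v - bf B x1 x2 / d1 B x1 * bf B x1 v)) := by
  have hev : (fun y : V d × V d × V d => bf B (p1h B α y.1 y.2.1 y.2.2) v)
      =ᶠ[nhds (x0, x1, x2)] fun y => α / √(d2 B y.2.1 y.2.2) *
        (bf B y.2.2 v - bf B y.2.1 y.2.2 / d1 B y.2.1 * bf B y.2.1 v) := by
    filter_upwards [(differentiable_d1 B).continuous.continuousAt.eventually_const_lt h1,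
      (differentiable_d2 hB).continuous.continuousAt.eventually_const_lt h2] with y hy1 hy2
    rw [p1h_eq hB hdet α hy1 hy2, bf_smul_left, bf_xi2_left hB]
  rw [hev.fderiv_eq]
  have hs : 0 < √(d2 B x1 x2) := Real.sqrt_pos.2 h2
  have hsq : √(d2 B x1 x2) ^ 2 = d2 B x1 x2 := Real.sq_sqrt h2.le
  apply fderiv_apply_eq_of_hasDerivAt
  · have e1 : DifferentiableAt ℝ (fun y : V d × V d × V d => d1 B y.2.1) (x0, x1, x2) :=
      (differentiable_d1 B).differentiableAt
    have e2 : DifferentiableAt ℝ (fun y : V d × V d × V d => d2 B y.2.1 y.2.2) (x0, x1, x2) :=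
      (differentiable_d2 hB).differentiableAt
    have e3 : Differentiable ℝ fun y : V d × V d × V d => bf B y.2.1 y.2.2 :=
      differentiable_bf B (by fun_prop) (by fun_prop)
    have e4 : Differentiable ℝ fun y : V d × V d × V d => bf B y.2.1 v :=
      differentiable_bf B (by fun_prop) (by fun_prop)
    have e5 : Differentiable ℝ fun y : V d × V d × V d => bf B y.2.2 v :=
      differentiable_bf B (by fun_prop) (by fun_prop)
    exact (differentiableAt_div (differentiableAt_const α) (e2.sqrt h2.ne') hs.ne').fun_mul
      (e5.differentiableAt.fun_sub
        ((differentiableAt_div e3.differentiableAt e1 h1.ne').fun_mul e4.differentiableAt))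
  · have hx := hasDerivAt_line x1 x2
    have hy := hasDerivAt_line x2 x3
    have hv := hasDerivAt_const (0 : ℝ) v
    have hD := (hasDerivAt_d2_line hB x1 x2 x2 x3).sqrt (by simpa using h2.ne')
    have hA := hasDerivAt_d1_line hB x1 x2
    refine (((hasDerivAt_const (0 : ℝ) α).fun_div hD (by simpa using hs.ne')).fun_mul
      ((hasDerivAt_bf B hy hv).fun_sub (((hasDerivAt_bf B hx hy).fun_div hA
        (by simpa using h1.ne')).fun_mul (hasDerivAt_bf B hx hv)))).congr_deriv ?_
    simp only [zero_smul, add_zero, bf_comm hB _ (0 : V d), bf_zero_left, ← d1_eq B x1, hsq]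
    generalize √(d2 B x1 x2) = s at hs hsq
    rw [← hsq]
    field_simp
    ring

/-- For the curvature Lagrangian `L = α√δ₂/δ₁`, at every
point with `δ₁ > 0` and `δ₂ > 0`, the partial differential of `L` with respect
to `x₁` is the covector
`v ↦ −(α/√δ₂)[(D_tδ₁/(2δ₁)) B(ξ₂,v) + (δ₂/δ₁²) B(ξ₁,v)]`
(with `D_tδ₁ = 2(x₁ x₂)`), and consequently `p̂⁰ = −(α/√δ₂) ξ₃`. -/
theorem curvature_p0hat
    (d : ℕ) (hd : 3 ≤ d) (B : Matrix (Fin d) (Fin d) ℝ)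
    (hBsymm : B.IsSymm) (hBnd : IsUnit B.det)
    (α : ℝ) (hα : α ≠ 0)
    (x0 x1 x2 x3 : V d) (h1 : 0 < d1 B x1) (h2 : 0 < d2 B x1 x2) :
    (∀ v : V d,
      fderiv ℝ (Lc B α) (x0, x1, x2) (0, v, 0) =
        -(α / Real.sqrt (d2 B x1 x2)) *
          ((2 * bf B x1 x2) / (2 * d1 B x1) * bf B (xi2 B x1 x2) v +
            d2 B x1 x2 / (d1 B x1)^2 * bf B x1 v)) ∧
    p0h B α x0 x1 x2 x3 = (-(α / Real.sqrt (d2 B x1 x2))) • xi3 B x1 x2 x3 := by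
  have hs : 0 < √(d2 B x1 x2) := Real.sqrt_pos.2 h2
  have hsq : √(d2 B x1 x2) ^ 2 = d2 B x1 x2 := Real.sq_sqrt h2.le
  have hd2 := d2_eq hBsymm x1 x2
  rw [← d1_eq] at hd2
  have hpartial : ∀ v : V d,
      fderiv ℝ (Lc B α) (x0, x1, x2) (0, v, 0) =
        -(α / Real.sqrt (d2 B x1 x2)) *
          ((2 * bf B x1 x2) / (2 * d1 B x1) * bf B (xi2 B x1 x2) v +
            d2 B x1 x2 / (d1 B x1)^2 * bf B x1 v) := by
    intro v
    rw [fderiv_Lc_apply hBsymm α h1 h2, bf_xi2_left hBsymm, bf_comm hBsymm x1 0,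
      bf_comm hBsymm x2 0, bf_zero_left, bf_zero_left]
    field_simp
    rw [hsq, hd2]
    ring
  refine ⟨hpartial, ?_⟩
  rw [p0h, ← inv_mulVec_bf_single hBsymm hBnd
    ((-(α / √(d2 B x1 x2))) • xi3 B x1 x2 x3)]
  congr 1
  funext a
  rw [hpartial, fderiv_bf_p1h hBsymm hBnd α x3 h1 h2, bf_smul_left,
    bf_xi3_left hBsymm x2 x3 _ h1, bf_xi2_left hBsymm]
  have hc : bf B x2 x2 = (d2 B x1 x2 + bf B x1 x2 ^ 2) / d1 B x1 := by
    rw [hd2]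
    field_simp
    ring
  rw [hc]
  field_simp
  ring

end
end
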